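/- arXiv:2009.12059 — 2 statements merged into one kernel-verified Lean document; each statement's English description precedes it below -/
import Mathlib

section
/- If a signed graph (G,σ) admits a homomorphism to a signed graph (H,π), then for every signature π' with (H,π') ∼ (H,π) there exists a signature σ' with (G,σ') ∼ (G,σ) such that (G,σ') admits a sign-preserving homomorphism to (H,π'). -/
open SimpleGraph

/-- A signed graph: a simple graph together with a symmetric sign function on
ordered pairs of vertices (`true` = positive, `false` = negative); only the values
on adjacent pairs are relevant. -/
structure SignedGraph (V : Type) where
  G : SimpleGraph V
  sign : V → V → Bool
  sign_symm : ∀ u v : V, sign u v = sign v u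

namespace SignedGraph

variable {V W : Type}

/-- The sign of a walk: `true` iff it traverses an even number of negative edges
(counted with multiplicity). -/
def walkSign (S : SignedGraph V) {u v : V} (w : S.G.Walk u v) : Bool :=
  (w.darts.map fun d => S.sign d.toProd.1 d.toProd.2).foldr (· == ·) true

/-- `SwitchEquiv S T` : `T` is obtained from `S` by switching a set of vertices
(encoded by `s : V → Bool`). -/
def SwitchEquiv (S T : SignedGraph V) : Prop :=
  S.G = T.G ∧ ∃ s : V → Bool, ∀ u v : V, S.G.Adj u v →
    T.sign u v = ((s u == s v) == S.sign u v)

/-- A sign-preserving homomorphism. -/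
def IsSpHom (S : SignedGraph V) (T : SignedGraph W) (f : V → W) : Prop :=
  ∀ u v : V, S.G.Adj u v →
    T.G.Adj (f u) (f v) ∧ T.sign (f u) (f v) = S.sign u v

/-- A homomorphism of signed graphs: maps edges to edges and preserves the signs of
closed walks. -/
def IsHom (S : SignedGraph V) (T : SignedGraph W) (f : V → W) : Prop :=
  ∃ hadj : ∀ u v : V, S.G.Adj u v → T.G.Adj (f u) (f v),
    ∀ (u : V) (w : S.G.Walk u u),
      T.walkSign (w.map ⟨f, fun {a b} h => hadj a b h⟩) = S.walkSign w

/-- A sign-preserving isomorphism. -/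
def IsSpIso (S : SignedGraph V) (T : SignedGraph W) (f : V → W) : Prop :=
  Function.Bijective f ∧ IsSpHom S T f ∧
    ∃ g : W → V, Function.LeftInverse g f ∧ Function.RightInverse g f ∧ IsSpHom T S g

/-- An isomorphism of signed graphs. -/
def IsIso (S : SignedGraph V) (T : SignedGraph W) (f : V → W) : Prop :=
  Function.Bijective f ∧ IsHom S T f ∧
    ∃ g : W → V, Function.LeftInverse g f ∧ Function.RightInverse g f ∧ IsHom T S g

/-- The sign-preserving chromatic number. -/
noncomputable def chromSp (S : SignedGraph V) : ℕ :=
  sInf {n : ℕ | ∃ T : SignedGraph (Fin n), ∃ f : V → Fin n, IsSpHom S T f}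

/-- The signed chromatic number. -/
noncomputable def chromS (S : SignedGraph V) : ℕ :=
  sInf {n : ℕ | ∃ T : SignedGraph (Fin n), ∃ f : V → Fin n, IsHom S T f}

/-- The double switching graph of a signed graph. -/
def doubleSwitch (S : SignedGraph V) : SignedGraph (V × Bool) where
  G := { Adj := fun p q => S.G.Adj p.1 q.1
         symm := ⟨fun p q h => S.G.symm.symm _ _ h⟩
         loopless := ⟨fun p h => S.G.loopless.irrefl p.1 h⟩ }
  sign := fun p q => ((p.2 == q.2) == S.sign p.1 q.1)
  sign_symm := by
    rintro ⟨p1, p2⟩ ⟨q1, q2⟩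
    have := S.sign_symm p1 q1
    cases p2 <;> cases q2 <;> simp [this]

end SignedGraph

/-- `G` has a complete minor on `n` branch sets: there are `n` nonempty, pairwise
disjoint vertex sets, each inducing a connected subgraph, with an edge of `G`
between any two of them. -/
def SimpleGraph.HasCompleteMinor {V : Type} (G : SimpleGraph V) (n : ℕ) : Prop :=
  ∃ B : Fin n → Set V,
    (∀ i, (B i).Nonempty) ∧
    (∀ i, (G.induce (B i)).Connected) ∧
    (∀ i j, i ≠ j → Disjoint (B i) (B j)) ∧
    (∀ i j, i ≠ j → ∃ u ∈ B i, ∃ v ∈ B j, G.Adj u v)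



namespace SignedGraph

theorem walkSign_cons {V : Type} (S : SignedGraph V) {u v w : V} (h : S.G.Adj u v)
    (p : S.G.Walk v w) :
    S.walkSign (SimpleGraph.Walk.cons h p) = (S.sign u v == S.walkSign p) := by
  simp [walkSign]

theorem walkSign_append {V : Type} (S : SignedGraph V) {u v w : V} (p : S.G.Walk u v)
    (q : S.G.Walk v w) : S.walkSign (p.append q) = (S.walkSign p == S.walkSign q) := by
  induction p with
  | nil => simp [walkSign]
  | cons h p ih =>
    rw [SimpleGraph.Walk.cons_append, walkSign_cons, walkSign_cons, ih]
    generalize S.walkSign p = a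
    generalize S.walkSign q = b
    generalize S.sign _ _ = c
    revert a b c; decide

theorem walkSign_reverse {V : Type} (S : SignedGraph V) {u v : V} (p : S.G.Walk u v) :
    S.walkSign p.reverse = S.walkSign p := by
  induction p with
  | nil => simp [walkSign]
  | @cons a b c h p ih =>
    rw [SimpleGraph.Walk.reverse_cons, walkSign_append, walkSign_cons, walkSign_cons, ih,
      S.sign_symm b a]
    have : S.walkSign (SimpleGraph.Walk.nil : S.G.Walk a a) = true := by simp [walkSign]
    rw [this]
    generalize S.walkSign p = a
    generalize S.sign _ _ = c
    revert a c; decide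

end SignedGraph

open SignedGraph in
/-- If `(G,σ) → (H,π)`, then for every `(H,π') ∼ (H,π)` there is `(G,σ') ∼ (G,σ)`
such that `(G,σ')` admits a sign-preserving homomorphism to `(H,π')`. -/
theorem exists_switchEquiv_spHom_of_isHom {V W : Type} [Fintype V] [Fintype W]
    (S : SignedGraph V) (T : SignedGraph W) (f : V → W) (hf : IsHom S T f) :
    ∀ T' : SignedGraph W, SwitchEquiv T' T →
      ∃ S' : SignedGraph V, SwitchEquiv S' S ∧ ∃ g : V → W, IsSpHom S' T' g := by
  classical
  rintro T' ⟨hG, t, ht⟩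
  obtain ⟨hadj, hw⟩ := hf
  let F : S.G →g T.G := ⟨f, fun {a b} h => hadj a b h⟩
  have hw' : ∀ (u : V) (w : S.G.Walk u u), T.walkSign (w.map F) = S.walkSign w := hw
  let r : V → V := fun v => (S.G.connectedComponentMk v).out
  have hr : ∀ v, S.G.Reachable (r v) v := fun v =>
    SimpleGraph.ConnectedComponent.exact (Quot.out_eq (S.G.connectedComponentMk v))
  have key : ∃ s : V → Bool, ∀ u v, S.G.Adj u v →
      S.sign u v = ((s u == s v) == T.sign (f u) (f v)) := by
    choose p _ using fun v => (⟨(hr v).some, trivial⟩ : ∃ _ : S.G.Walk (r v) v, True)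
    refine ⟨fun v => (T.walkSign ((p v).map F) == S.walkSign (p v)), fun u v h => ?_⟩
    have hruv : r u = r v := by
      simp only [r]
      rw [SimpleGraph.ConnectedComponent.sound h.reachable]
    have gen : ∀ (a b : V) (_ : a = b) (q : S.G.Walk a u) (q' : S.G.Walk b v),
        S.sign u v = (((T.walkSign (q.map F) == S.walkSign q) ==
          (T.walkSign (q'.map F) == S.walkSign q')) == T.sign (f u) (f v)) := by
      rintro a _ rfl q q'
      have h1 := hw' a (q.append (SimpleGraph.Walk.cons h q'.reverse))
      rw [SimpleGraph.Walk.map_append, SimpleGraph.Walk.map_cons, ← SimpleGraph.Walk.reverse_map,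
        walkSign_append,
        walkSign_append, walkSign_cons, walkSign_cons, walkSign_reverse, walkSign_reverse] at h1
      change (_ == (T.sign (f u) (f v) == _)) = _ at h1
      revert h1
      generalize T.walkSign (q.map F) = x1
      generalize T.walkSign (q'.map F) = x2
      generalize S.walkSign q = x3
      generalize S.walkSign q' = x4
      generalize S.sign u v = x5
      generalize T.sign (f u) (f v) = x6
      revert x1 x2 x3 x4 x5 x6
      decide
    exact gen _ _ hruv (p u) (p v)
  obtain ⟨s, hs⟩ := key
  refine ⟨⟨S.G, fun u v => T'.sign (f u) (f v), fun u v => T'.sign_symm _ _⟩,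
    ⟨rfl, fun v => (s v == t (f v)), fun u v h => ?_⟩, f, fun u v h => ⟨?_, rfl⟩⟩
  · have h2 : T'.G.Adj (f u) (f v) := by rw [hG]; exact hadj u v h
    rw [hs u v h, ht _ _ h2]
    dsimp only
    generalize T'.sign (f u) (f v) = x1
    generalize s u = x2
    generalize s v = x3
    generalize t (f u) = x4
    generalize t (f v) = x5
    revert x1 x2 x3 x4 x5
    decide
  · rw [hG]; exact hadj u v h
end

section
/- The maximum of χ_s((G,σ)) over all connected finite simple graphs G with maximum degree at most 3 and all signatures σ of G equals 6; that is, every connected signed graph of maximum degree at most 3 has signed chromatic number at most 6, and some connected signed graph of maximum degree at most 3 has signed chromatic number exactly 6. -/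
open SimpleGraph

namespace SubcubicProof

/-- Adjacency table of the icosahedron on the points `0, …, 11`; antipodes are `2i`, `2i+1`. -/
def tbl : ℕ := 3713615167969122945781435808328929014810020

/-- Neighbourhood bit mask. -/
def nb (p : ℕ) : ℕ := (tbl >>> (12 * p)) &&& 4095

/-- antipode -/
def fl (b : Bool) (p : Fin 12) : Fin 12 :=
  if b then p else ⟨p.1 ^^^ 1, by revert p; decide⟩

/-- signed adjacency of the twelve points -/
def adj (s : Bool) (p q : Fin 12) : Bool := (nb (fl s q).1).testBit p.1

/-- three neighbourhoods have a common point -/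
def g3 (a b c : Fin 12) : Bool := nb a.1 &&& nb b.1 &&& nb c.1 != 0

theorem adj_symm : ∀ s p q, adj s p q = adj s q p := by decide +kernel

theorem adj_fl : ∀ s a b p q, adj s (fl a p) (fl b q) = adj (s == (a == b)) p q := by
  decide +kernel

theorem fl_fl : ∀ s p, fl s (fl s p) = p := by decide +kernel

theorem adj_out : ∀ s p q, adj s p q = adj true p (fl s q) := by decide +kernel

theorem adj_line : ∀ s p q, adj s p q = true → p.1 / 2 ≠ q.1 / 2 ∧
    adj true ⟨2 * (p.1 / 2), by omega⟩ ⟨2 * (q.1 / 2), by omega⟩ =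
      (((p.1 % 2 == 0) == (q.1 % 2 == 0)) == s) := by decide +kernel

theorem g3_spec : ∀ a b c, g3 a b c = true →
    ∃ x, adj true x a = true ∧ adj true x b = true ∧ adj true x c = true := by decide +kernel

/-- options for a point with two prescribed neighbours -/
def opt2 (a b : Fin 12) : Finset (Fin 12) :=
  Finset.univ.filter fun c => adj true c a = true ∧ adj true c b = true

def opt1 (a : Fin 12) : Finset (Fin 12) :=
  Finset.univ.filter fun c => adj true c a = true

theorem opt1_card : ∀ a, (opt1 a).card = 5 := by decide +kernel

theorem opt2_card : ∀ a b, a ≠ fl false b → 2 ≤ (opt2 a b).card := by decide +kernel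

theorem opt1_two : ∀ a, ∃ q q', q ∈ opt1 a ∧ q' ∈ opt1 a ∧ q' ≠ q ∧ q' ≠ fl false q := by
  decide +kernel

theorem opt2_two : ∀ a b, a ≠ fl false b →
    ∃ q q', q ∈ opt2 a b ∧ q' ∈ opt2 a b ∧ q' ≠ q ∧ q' ≠ fl false q := by decide +kernel

/-- points seen by one of two points -/
def see (s : Bool) (q q' : Fin 12) : Finset (Fin 12) :=
  Finset.univ.filter fun c => adj s c q = true ∨ adj s c q' = true

theorem see_card : ∀ s q q', q' ≠ q → q' ≠ fl false q → (see s q q').card = 8 := by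
  decide +kernel

theorem see_three : ∀ s, ∀ a b, b ≠ a → ∀ c, c ≠ a → c ≠ b →
    (Finset.univ.filter fun x => ¬ (adj s x a = true ∨ adj s x b = true ∨ adj s x c = true)).card
      ≤ 3 := by decide +kernel

theorem tri_core : ∀ s p1 p2, ∃ z, ∀ q, q ≠ z → ∃ u1, adj true u1 p1 = true ∧ ∃ u2,
    adj true u2 p2 = true ∧ adj s u1 u2 = true ∧ g3 u1 u2 q = true := by decide +kernel

def allP : List (Fin 12) := List.finRange 12

theorem c4_core_check : ∀ s : Bool, (allP.all fun p1 => allP.all fun p3 =>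
    let l := (allP.filter fun x => adj true x p1).flatMap fun x1 =>
      (allP.filter fun x => adj true x p3).map fun x3 =>
        (nb x1.1 &&& nb x3.1, nb x3.1 &&& nb (fl s x1).1)
    allP.all fun p2 => allP.all fun p4 => l.any fun m =>
      (m.1 &&& nb p2.1 != 0) && (m.2 &&& nb p4.1 != 0)) = true := by decide +kernel

end SubcubicProof
namespace SubcubicProof

open SignedGraph Finset Classical

section

variable {V : Type}

/-- the edge condition at `u v` -/
def ok (S : SignedGraph V) (c : V → Fin 12) (u v : V) : Prop :=
  adj (S.sign u v) (c u) (c v) = true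

theorem ok_symm {S : SignedGraph V} {c : V → Fin 12} {u v : V} (h : ok S c u v) : ok S c v u := by
  unfold ok at *
  rw [adj_symm, S.sign_symm]; exact h

/-- the colors of `v, w` are compatible at `y` -/
def cmp (S : SignedGraph V) (c : V → Fin 12) (y v w : V) : Prop :=
  fl (S.sign y v) (c v) ≠ fl false (fl (S.sign y w) (c w))

theorem fl_inj : ∀ s p q, fl s p = fl s q → p = q := by decide +kernel

theorem anti_symm : ∀ p q, p = fl false q → q = fl false p := by decide +kernel

theorem cmp_symm {S : SignedGraph V} {c : V → Fin 12} {y v w : V} (h : cmp S c y v w) :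
    cmp S c y w v := fun h' => h (anti_symm _ _ h')

/-- good partial colorings -/
def Good (S : SignedGraph V) (U : Finset V) (c : V → Fin 12) : Prop :=
  (∀ u ∈ U, ∀ v ∈ U, S.G.Adj u v → ok S c u v) ∧
  ∀ y, y ∉ U → ∀ v ∈ U, ∀ w ∈ U, v ≠ w → S.G.Adj y v → S.G.Adj y w → cmp S c y v w

theorem opts [Fintype V] {S : SignedGraph V} {U : Finset V} {c : V → Fin 12} (h : Good S U c)
    {y : V} (hy : y ∉ U) (hc : (S.G.neighborFinset y ∩ U).card ≤ 2) :
    ∃ O : Finset (Fin 12),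
      (∀ a ∈ O, ∀ w ∈ U, S.G.Adj y w → adj (S.sign y w) a (c w) = true) ∧
      4 ≤ O.card + (S.G.neighborFinset y ∩ U).card ∧
      ∃ q ∈ O, ∃ q' ∈ O, q' ≠ q ∧ q' ≠ fl false q := by
  have hmem : ∀ w, w ∈ S.G.neighborFinset y ∩ U ↔ S.G.Adj y w ∧ w ∈ U := by
    intro w; simp
  generalize hN : S.G.neighborFinset y ∩ U = N at *
  have h3 : N.card = 0 ∨ N.card = 1 ∨ N.card = 2 := by omega
  rcases h3 with h0 | h1 | h2
  · rw [Finset.card_eq_zero] at h0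
    refine ⟨univ, ?_, ?_, 0, mem_univ _, 2, mem_univ _, by decide, by decide⟩
    · intro a _ w hw hyw
      have := (hmem w).2 ⟨hyw, hw⟩
      simp [h0] at this
    · rw [Finset.card_univ, Fintype.card_fin]; omega
  · obtain ⟨w0, hw0⟩ := Finset.card_eq_one.1 h1
    obtain ⟨q, q', hq, hq', h1', h2'⟩ := opt1_two (fl (S.sign y w0) (c w0))
    refine ⟨opt1 (fl (S.sign y w0) (c w0)), ?_, ?_, q, hq, q', hq', h1', h2'⟩
    · intro a ha w hw hyw
      have := (hmem w).2 ⟨hyw, hw⟩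
      rw [hw0, mem_singleton] at this
      subst this
      simpa [opt1, ← adj_out] using ha
    · rw [opt1_card]; omega
  · obtain ⟨w0, w1, hne, hw0⟩ := Finset.card_eq_two.1 h2
    have m0 := (hmem w0).1 (by simp [hw0])
    have m1 := (hmem w1).1 (by simp [hw0])
    have hcm : cmp S c y w0 w1 := h.2 y hy w0 m0.2 w1 m1.2 hne m0.1 m1.1
    obtain ⟨q, q', hq, hq', h1', h2'⟩ := opt2_two _ _ hcm
    refine ⟨_, ?_, ?_, q, hq, q', hq', h1', h2'⟩
    · intro a ha w hw hyw
      have := (hmem w).2 ⟨hyw, hw⟩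
      rw [hw0, mem_insert, mem_singleton] at this
      simp only [opt2, ← adj_out, mem_filter, mem_univ, true_and] at ha
      rcases this with rfl | rfl
      · exact ha.1
      · exact ha.2
    · have := opt2_card _ _ hcm; omega

theorem good_step [Fintype V] {S : SignedGraph V} {U : Finset V} {c : V → Fin 12}
    (h : Good S U c) {v : V} (hv : v ∉ U) (hc : (S.G.neighborFinset v ∩ U).card ≤ 2)
    (hd : (S.G.neighborFinset v).card ≤ 3)
    (hy : ∀ y, y ∉ U → S.G.Adj v y → (S.G.neighborFinset y ∩ U).card ≤ 1) :
    ∃ c', Good S (insert v U) c' := by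
  obtain ⟨O, hO, hcard, -⟩ := opts h hv hc
  have hz : ∀ y, ∃ z : Fin 12, y ∉ U → S.G.Adj v y → ∀ a, a ≠ z → ∀ w ∈ U, S.G.Adj y w →
      fl (S.sign y v) a ≠ fl false (fl (S.sign y w) (c w)) := by
    intro y
    by_cases hyy : y ∉ U ∧ S.G.Adj v y
    · by_cases hw : ∃ w ∈ U, S.G.Adj y w
      · obtain ⟨w, hwU, hyw⟩ := hw
        refine ⟨fl (S.sign y v) (fl false (fl (S.sign y w) (c w))), ?_⟩
        intro _ _ a ha w' hw' hyw' heq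
        have : w' = w := by
          have := Finset.card_le_one.1 (hy y hyy.1 hyy.2)
          exact this w' (by simp [hw', hyw']) w (by simp [hwU, hyw])
        subst this
        apply ha
        rw [← heq, fl_fl]
      · exact ⟨0, fun _ _ a _ w hwU hyw => absurd ⟨w, hwU, hyw⟩ hw⟩
    · exact ⟨0, fun h1 h2 => absurd ⟨h1, h2⟩ hyy⟩
  choose z hz using hz
  have hZ : ((S.G.neighborFinset v \ U).image z).card < O.card := by
    have h1 := Finset.card_image_le (s := S.G.neighborFinset v \ U) (f := z)
    have h2 := Finset.card_sdiff_add_card_inter (S.G.neighborFinset v) U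
    omega
  obtain ⟨a, haO, haZ⟩ := Finset.exists_mem_notMem_of_card_lt_card hZ
  have key : ∀ y, y ∉ U → S.G.Adj v y → ∀ w ∈ U, S.G.Adj y w →
      fl (S.sign y v) a ≠ fl false (fl (S.sign y w) (c w)) := by
    intro y hyU hvy
    apply hz y hyU hvy a
    rintro rfl
    exact haZ (mem_image_of_mem _ (by simp [hyU, hvy]))
  have hne : ∀ w ∈ U, w ≠ v := fun w hw hwv => hv (hwv ▸ hw)
  have okv : ∀ w ∈ U, S.G.Adj v w → ok S (Function.update c v a) v w := by
    intro w hw hvw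
    simp only [ok, Function.update_self, Function.update_of_ne (hne w hw)]
    exact hO a haO w hw hvw
  refine ⟨Function.update c v a, ?_, ?_⟩
  · intro u hu w hw huw
    rw [mem_insert] at hu hw
    rcases hu with rfl | hu <;> rcases hw with rfl | hw
    · exact absurd huw (S.G.irrefl)
    · exact okv w hw huw
    · exact ok_symm (okv u hu huw.symm)
    · simp only [ok, Function.update_of_ne (hne w hw), Function.update_of_ne (hne u hu)]
      exact h.1 u hu w hw huw
  · intro y hyU u hu w hw huw hyu hyw
    rw [mem_insert, not_or] at hyU
    have kk : ∀ w ∈ U, S.G.Adj y w → S.G.Adj y v → cmp S (Function.update c v a) y v w := by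
      intro w hw hyw hyv
      simp only [cmp, Function.update_self, Function.update_of_ne (hne w hw)]
      exact key y hyU.2 hyv.symm w hw hyw
    rw [mem_insert] at hu hw
    rcases hu with rfl | hu <;> rcases hw with rfl | hw
    · exact absurd rfl huw
    · exact kk w hw hyw hyu
    · exact cmp_symm (kk u hu hyu hyw)
    · simp only [cmp, Function.update_of_ne (hne w hw), Function.update_of_ne (hne u hu)]
      exact h.2 y hyU.2 u hu w hw huw hyu hyw

theorem closer {G : SimpleGraph V} (hG : G.Connected) (x y : V) (h : y ≠ x) :
    ∃ z, G.Adj y z ∧ G.dist x z < G.dist x y := by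
  obtain ⟨p, hp⟩ := hG.exists_walk_length_eq_dist y x
  cases p with
  | nil => exact absurd rfl h
  | cons hadj q =>
    refine ⟨_, hadj, ?_⟩
    have := SimpleGraph.dist_le q
    rw [G.dist_comm, G.dist_comm (u := x), ← hp, SimpleGraph.Walk.length_cons]
    omega

theorem good_all [Fintype V] {S : SignedGraph V} (hG : S.G.Connected)
    (hd : ∀ v, (S.G.neighborFinset v).card ≤ 3) (K : Finset V) (x : V) (hx : x ∈ K)
    (hK : ∀ y ∈ K, (S.G.neighborFinset y \ K).card ≤ 2) :
    ∀ n, ∀ U : Finset V, U.card = n → (∀ v ∈ U, v ∉ K) →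
      (∀ v ∈ U, ∀ w, w ∉ K → S.G.dist x v < S.G.dist x w → w ∈ U) → ∃ c, Good S U c := by
  intro n
  induction n with
  | zero =>
    intro U hU _ _
    rw [Finset.card_eq_zero] at hU
    subst hU
    exact ⟨fun _ => 0, by simp [Good]⟩
  | succ n ih =>
    intro U hU hUK hcl
    have hne : U.Nonempty := by rw [← Finset.card_pos]; omega
    obtain ⟨v, hvU, hmin⟩ := Finset.exists_min_image U (fun v => S.G.dist x v) hne
    obtain ⟨c, hc⟩ := ih (U.erase v) (by rw [Finset.card_erase_of_mem hvU]; omega)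
      (fun w hw => hUK w (mem_of_mem_erase hw))
      (by
        intro u hu w hw hlt
        have huU := mem_of_mem_erase hu
        rw [mem_erase]
        refine ⟨?_, hcl u huU w hw hlt⟩
        rintro rfl
        have := hmin u huU
        omega)
    have hsmall : ∀ z, S.G.dist x z < S.G.dist x v → z ∉ U := by
      intro z hz hzU
      have := hmin z hzU
      omega
    have := good_step hc (v := v) (by simp) ?_ (hd v) ?_
    · rwa [insert_erase hvU] at this
    · obtain ⟨z, hvz, hz⟩ := closer hG x v (by rintro rfl; exact hUK _ hvU hx)
      have : S.G.neighborFinset v ∩ U.erase v ⊆ (S.G.neighborFinset v).erase z := by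
        intro w hw
        simp only [mem_inter, mem_erase] at hw ⊢
        refine ⟨?_, hw.1⟩
        rintro rfl
        exact hsmall _ hz hw.2.2
      have := card_le_card this
      rw [card_erase_of_mem (by simpa using hvz)] at this
      have := hd v
      omega
    · intro y hy hvy
      have hyv : y ≠ v := hvy.ne'
      have hyU : y ∉ U := fun h => hy (mem_erase.2 ⟨hyv, h⟩)
      by_cases hyK : y ∈ K
      · have : S.G.neighborFinset y ∩ U.erase v ⊆ (S.G.neighborFinset y \ K).erase v := by
          intro w hw
          simp only [mem_inter, mem_erase, mem_sdiff] at hw ⊢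
          exact ⟨hw.2.1, hw.1, hUK w hw.2.2⟩
        have := card_le_card this
        rw [card_erase_of_mem (by simpa using ⟨hvy.symm, hUK v hvU⟩)] at this
        have := hK y hyK
        omega
      · have hle : S.G.dist x y ≤ S.G.dist x v := by
          by_contra hlt
          exact hyU (hcl v hvU y hyK (by omega))
        obtain ⟨z, hyz, hz⟩ := closer hG x y (by rintro rfl; exact hyK hx)
        have : S.G.neighborFinset y ∩ U.erase v ⊆ ((S.G.neighborFinset y).erase z).erase v := by
          intro w hw
          simp only [mem_inter, mem_erase] at hw ⊢
          refine ⟨hw.2.1, ?_, hw.1⟩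
          rintro rfl
          exact hsmall _ (by omega) hw.2.2
        have := card_le_card this
        have hvz : v ≠ z := by rintro rfl; omega
        rw [card_erase_of_mem (by simpa using ⟨hvz, hvy.symm⟩),
          card_erase_of_mem (by simpa using hyz)] at this
        have := hd y
        omega

theorem good_compl [Fintype V] {S : SignedGraph V} (hG : S.G.Connected)
    (hd : ∀ v, (S.G.neighborFinset v).card ≤ 3) (K : Finset V) (x : V) (hx : x ∈ K)
    (hK : ∀ y ∈ K, (S.G.neighborFinset y \ K).card ≤ 2) : ∃ c, Good S Kᶜ c :=
  good_all hG hd K x hx hK _ _ rfl (by simp) (by intro v _ w hw _; simpa using hw)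

theorem nb_inter_compl [Fintype V] {S : SignedGraph V} (K : Finset V) (y : V) :
    S.G.neighborFinset y ∩ Kᶜ = S.G.neighborFinset y \ K := by
  ext; simp

/-- two options for a core vertex with at most two outer neighbours -/
theorem two_opts [Fintype V] {S : SignedGraph V} {K : Finset V} {c : V → Fin 12}
    (h : Good S Kᶜ c) {y : V} (hy : y ∈ K) (hc : (S.G.neighborFinset y \ K).card ≤ 2) :
    ∃ q q', (q' ≠ q ∧ q' ≠ fl false q) ∧ ∀ a, (a = q ∨ a = q') →
      ∀ w, w ∉ K → S.G.Adj y w → adj (S.sign y w) a (c w) = true := by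
  obtain ⟨O, hO, -, q, hq, q', hq', h1⟩ :=
    opts h (y := y) (by simpa using hy) (by rwa [nb_inter_compl])
  refine ⟨q, q', h1, ?_⟩
  rintro a ha w hw hyw
  refine hO a ?_ w (by simpa using hw) hyw
  rcases ha with rfl | rfl <;> assumption

/-- a core vertex with at most one outer neighbour -/
theorem one_opt [Fintype V] {S : SignedGraph V} {K : Finset V} (c : V → Fin 12)
    {y : V} (hc : (S.G.neighborFinset y \ K).card ≤ 1) :
    ∃ p, ∀ a, adj true a p = true →
      ∀ w, w ∉ K → S.G.Adj y w → adj (S.sign y w) a (c w) = true := by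
  by_cases hw : ∃ w, w ∉ K ∧ S.G.Adj y w
  · obtain ⟨w, hwK, hyw⟩ := hw
    refine ⟨fl (S.sign y w) (c w), ?_⟩
    intro a ha w' hw' hyw'
    have : w' = w := Finset.card_le_one.1 hc w' (by simp [hw', hyw']) w (by simp [hwK, hyw])
    subst this
    rwa [adj_out]
  · exact ⟨0, fun a _ w h1 h2 => absurd ⟨w, h1, h2⟩ hw⟩

theorem finish [Fintype V] {S : SignedGraph V} {K : Finset V} {c : V → Fin 12}
    (h : Good S Kᶜ c) (f : V → Fin 12) (hf : ∀ v, v ∉ K → f v = c v)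
    (hK : ∀ y ∈ K, ∀ w, S.G.Adj y w → ok S f y w) : ∀ u v, S.G.Adj u v → ok S f u v := by
  intro u v huv
  by_cases hu : u ∈ K
  · exact hK u hu v huv
  by_cases hv : v ∈ K
  · exact ok_symm (hK v hv u huv.symm)
  · have := h.1 u (by simpa using hu) v (by simpa using hv) huv
    simp only [ok, hf u hu, hf v hv] at this ⊢
    exact this

/-- target -/
def target : SignedGraph (Fin 6) where
  G := ⊤
  sign i j := adj true ⟨2 * i.1, by omega⟩ ⟨2 * j.1, by omega⟩
  sign_symm i j := adj_symm _ _ _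

theorem walkSign_cons (S : SignedGraph V) {u v w : V} (h : S.G.Adj u v) (p : S.G.Walk v w) :
    S.walkSign (SimpleGraph.Walk.cons h p) = (S.sign u v == S.walkSign p) := rfl

theorem chromS_le_of_col (S : SignedGraph V) (f : V → Fin 12)
    (h : ∀ u v, S.G.Adj u v → ok S f u v) : chromS S ≤ 6 := by
  apply Nat.sInf_le
  have hl : ∀ v, (f v).1 / 2 < 6 := fun v => by have := (f v).2; omega
  have hadj : ∀ u v, S.G.Adj u v →
      target.G.Adj (⟨(f u).1 / 2, hl u⟩ : Fin 6) ⟨(f v).1 / 2, hl v⟩ := by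
    intro u v huv
    have := (adj_line _ _ _ (h u v huv)).1
    simp only [target, SimpleGraph.top_adj, ne_eq, Fin.mk.injEq]
    exact this
  refine ⟨target, fun v => ⟨(f v).1 / 2, hl v⟩, hadj, ?_⟩
  have gen : ∀ (u v : V) (w : S.G.Walk u v),
      target.walkSign (w.map ⟨fun v => ⟨(f v).1 / 2, hl v⟩, fun {a b} h => hadj a b h⟩) =
        ((((f u).1 % 2 == 0) == ((f v).1 % 2 == 0)) == S.walkSign w) := by
    intro u v w
    induction w with
    | nil => simp [walkSign]
    | @cons a b d hab p ih =>
      rw [SimpleGraph.Walk.map_cons, walkSign_cons, walkSign_cons, ih]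
      have := (adj_line _ _ _ (h a b hab)).2
      have e1 : target.sign (⟨(f a).1 / 2, hl a⟩ : Fin 6) ⟨(f b).1 / 2, hl b⟩ = _ := this
      refine (congrArg (fun t => t == _) e1).trans ?_
      generalize ((f a).1 % 2 == 0) = x1
      generalize ((f b).1 % 2 == 0) = x2
      generalize ((f d).1 % 2 == 0) = x3
      generalize S.sign a b = x4
      generalize S.walkSign p = x5
      revert x1 x2 x3 x4 x5
      decide
  intro u w
  rw [gen]; simp

theorem chromS_le_card [Fintype V] (S : SignedGraph V) : chromS S ≤ Fintype.card V := by
  apply Nat.sInf_le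
  let e := Fintype.equivFin V
  let T : SignedGraph (Fin (Fintype.card V)) :=
    { G := S.G.comap e.symm
      sign := fun i j => S.sign (e.symm i) (e.symm j)
      sign_symm := fun i j => S.sign_symm _ _ }
  have hadj : ∀ u v, S.G.Adj u v → T.G.Adj (e u) (e v) := by
    intro u v huv
    simpa [T] using huv
  refine ⟨T, e, hadj, ?_⟩
  have gen : ∀ (u v : V) (w : S.G.Walk u v),
      T.walkSign (w.map ⟨e, fun {a b} h => hadj a b h⟩) = S.walkSign w := by
    intro u v w
    induction w with
    | nil => simp [walkSign]
    | @cons a b d hab p ih =>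
      rw [SimpleGraph.Walk.map_cons, walkSign_cons, walkSign_cons, ih]
      have : T.sign (e a) (e b) = S.sign a b := by simp [T]
      rw [← this]; rfl
  intro u w
  exact gen u u w

end

end SubcubicProof
namespace SubcubicProof

open SignedGraph Finset Classical

theorem c4_core (s : Bool) (p1 p2 p3 p4 : Fin 12) : ∃ x1 x2 x3 x4 : Fin 12,
    adj true x1 p1 = true ∧ adj true x2 p2 = true ∧ adj true x3 p3 = true ∧
    adj true x4 p4 = true ∧ adj true x1 x2 = true ∧ adj true x2 x3 = true ∧
    adj true x3 x4 = true ∧ adj s x4 x1 = true := by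
  have h := c4_core_check s
  have hP : ∀ p, p ∈ allP := fun p => List.mem_finRange p
  rw [List.all_eq_true] at h
  have h := h p1 (hP _)
  rw [List.all_eq_true] at h
  have h := h p3 (hP _)
  dsimp only at h
  rw [List.all_eq_true] at h
  have h := h p2 (hP _)
  rw [List.all_eq_true] at h
  have h := h p4 (hP _)
  rw [List.any_eq_true] at h
  obtain ⟨m, hm, hb⟩ := h
  rw [List.mem_flatMap] at hm
  obtain ⟨x1, hx1, hm⟩ := hm
  rw [List.mem_map] at hm
  obtain ⟨x3, hx3, rfl⟩ := hm
  rw [Bool.and_eq_true] at hb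
  obtain ⟨x2, h21, h23, h2⟩ := g3_spec x1 x3 p2 hb.1
  obtain ⟨x4, h43, h41, h4⟩ := g3_spec x3 (fl s x1) p4 hb.2
  refine ⟨x1, x2, x3, x4, (List.mem_filter.1 hx1).2, h2, (List.mem_filter.1 hx3).2, h4, ?_, h23,
    ?_, ?_⟩
  · rwa [adj_symm]
  · rwa [adj_symm]
  · rwa [adj_out]

theorem adj_fl_left (b : Bool) (p q : Fin 12) : adj true (fl b p) q = adj true p (fl b q) := by
  have h1 := adj_fl true b true p q
  have h2 := adj_fl true true b p q
  have h3 : ∀ r, fl true r = r := fun r => rfl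
  rw [h3] at h1 h2
  rw [h1, h2]
  cases b <;> rfl

theorem c4_gen (s12 s23 s34 s41 : Bool) (p1 p2 p3 p4 : Fin 12) : ∃ x1 x2 x3 x4 : Fin 12,
    adj true x1 p1 = true ∧ adj true x2 p2 = true ∧ adj true x3 p3 = true ∧
    adj true x4 p4 = true ∧ adj s12 x1 x2 = true ∧ adj s23 x2 x3 = true ∧
    adj s34 x3 x4 = true ∧ adj s41 x4 x1 = true := by
  obtain ⟨x1, x2, x3, x4, h1, h2, h3, h4, h5, h6, h7, h8⟩ :=
    c4_core (s12 == (s23 == (s34 == s41))) p1 (fl s12 p2) (fl (s12 == s23) p3)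
      (fl (s12 == (s23 == s34)) p4)
  refine ⟨fl true x1, fl s12 x2, fl (s12 == s23) x3, fl (s12 == (s23 == s34)) x4,
    h1, ?_, ?_, ?_, ?_, ?_, ?_, ?_⟩
  · rwa [adj_fl_left]
  · rwa [adj_fl_left]
  · rwa [adj_fl_left]
  all_goals
    rw [adj_fl]
    revert h5 h6 h7 h8
    cases s12 <;> cases s23 <;> cases s34 <;> cases s41 <;> simp +contextual

theorem tri_gen (s12 s1 s2 s3 : Bool) (p1 p2 q q' : Fin 12) (hq : q' ≠ q) :
    ∃ u1 u2 u3 x : Fin 12, (u3 = q ∨ u3 = q') ∧ adj true u1 p1 = true ∧ adj true u2 p2 = true ∧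
      adj s12 u1 u2 = true ∧ adj s1 x u1 = true ∧ adj s2 x u2 = true ∧ adj s3 x u3 = true := by
  obtain ⟨z, hz⟩ := tri_core (s12 == (s1 == s2)) (fl s1 p1) (fl s2 p2)
  have : ∃ u3, (u3 = q ∨ u3 = q') ∧ fl s3 u3 ≠ z := by
    by_cases h : fl s3 q = z
    · refine ⟨q', Or.inr rfl, ?_⟩
      intro h'
      exact hq (fl_inj s3 _ _ (h'.trans h.symm))
    · exact ⟨q, Or.inl rfl, h⟩
  obtain ⟨u3, hu3, hne⟩ := this
  obtain ⟨u1, h1, u2, h2, h12, hg⟩ := hz _ hne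
  obtain ⟨x, hx1, hx2, hx3⟩ := g3_spec _ _ _ hg
  refine ⟨fl s1 u1, fl s2 u2, u3, x, hu3, ?_, ?_, ?_, ?_, ?_, ?_⟩
  · rwa [adj_fl_left]
  · rwa [adj_fl_left]
  · rw [adj_fl]
    revert h12
    cases s12 <;> cases s1 <;> cases s2 <;> simp
  · rwa [adj_out, fl_fl]
  · rwa [adj_out, fl_fl]
  · rwa [adj_out]

theorem see_inter (s t : Bool) (a a' b b' : Fin 12) (ha : a' ≠ a ∧ a' ≠ fl false a)
    (hb : b' ≠ b ∧ b' ≠ fl false b) : 4 ≤ (see s a a' ∩ see t b b').card := by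
  have h1 := see_card s a a' ha.1 ha.2
  have h2 := see_card t b b' hb.1 hb.2
  have h3 := card_union_add_card_inter (see s a a') (see t b b')
  have h4 := card_le_univ (see s a a' ∪ see t b b')
  rw [Fintype.card_fin] at h4
  omega

theorem ds_gen (s sa sb sc sd : Bool) (a a' b b' c c' d d' : Fin 12)
    (ha : a' ≠ a ∧ a' ≠ fl false a) (hb : b' ≠ b ∧ b' ≠ fl false b)
    (hc : c' ≠ c ∧ c' ≠ fl false c) (hd : d' ≠ d ∧ d' ≠ fl false d) :
    ∃ x y ua ub uc ud, (ua = a ∨ ua = a') ∧ (ub = b ∨ ub = b') ∧ (uc = c ∨ uc = c') ∧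
      (ud = d ∨ ud = d') ∧ adj s x y = true ∧ adj sa x ua = true ∧ adj sb x ub = true ∧
      adj sc y uc = true ∧ adj sd y ud = true := by
  have hX := see_inter sa sb a a' b b' ha hb
  have hY := see_inter sc sd c c' d d' hc hd
  have : ∃ x ∈ see sa a a' ∩ see sb b b', ∃ y ∈ see sc c c' ∩ see sd d d', adj s x y = true := by
    by_contra hcon
    push Not at hcon
    obtain ⟨y1, h1, y2, h2, y3, h3, h12, h13, h23⟩ := Finset.two_lt_card.1 (by omega :
      2 < (see sc c c' ∩ see sd d d').card)
    have hle := see_three s y1 y2 h12.symm y3 h13.symm h23.symm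
    have hsub : see sa a a' ∩ see sb b b' ⊆ (Finset.univ.filter fun x =>
        ¬ (adj s x y1 = true ∨ adj s x y2 = true ∨ adj s x y3 = true)) := by
      intro x hx
      have e1 := hcon x hx y1 h1
      have e2 := hcon x hx y2 h2
      have e3 := hcon x hx y3 h3
      simp [e1, e2, e3]
    have := card_le_card hsub
    have h5 := this.trans hle
    omega
  obtain ⟨x, hx, y, hy, hxy⟩ := this
  simp only [see, mem_inter, mem_filter, mem_univ, true_and] at hx hy
  have pick : ∀ (t : Bool) (x e e' : Fin 12), adj t x e = true ∨ adj t x e' = true →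
      ∃ u, (u = e ∨ u = e') ∧ adj t x u = true := by
    rintro t x e e' (h | h)
    · exact ⟨e, Or.inl rfl, h⟩
    · exact ⟨e', Or.inr rfl, h⟩
  obtain ⟨ua, h1, h1'⟩ := pick _ _ _ _ hx.1
  obtain ⟨ub, h2, h2'⟩ := pick _ _ _ _ hx.2
  obtain ⟨uc, h3, h3'⟩ := pick _ _ _ _ hy.1
  obtain ⟨ud, h4, h4'⟩ := pick _ _ _ _ hy.2
  exact ⟨x, y, ua, ub, uc, ud, h1, h2, h3, h4, hxy, h1', h2', h3', h4'⟩

section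

variable {V : Type} [Fintype V] {S : SignedGraph V}

theorem out_two (hd : ∀ v, (S.G.neighborFinset v).card ≤ 3) {K : Finset V} {y a : V}
    (h : S.G.Adj y a) (ha : a ∈ K) : (S.G.neighborFinset y \ K).card ≤ 2 := by
  have : S.G.neighborFinset y \ K ⊆ (S.G.neighborFinset y).erase a := by
    intro w hw
    rw [mem_sdiff] at hw
    exact mem_erase.2 ⟨by rintro rfl; exact hw.2 ha, hw.1⟩
  have := card_le_card this
  rw [card_erase_of_mem (by simpa using h)] at this
  have := hd y
  omega

theorem out_one (hd : ∀ v, (S.G.neighborFinset v).card ≤ 3) {K : Finset V} {y a b : V}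
    (h : S.G.Adj y a) (ha : a ∈ K) (h' : S.G.Adj y b) (hb : b ∈ K) (hab : a ≠ b) :
    (S.G.neighborFinset y \ K).card ≤ 1 := by
  have : S.G.neighborFinset y \ K ⊆ ((S.G.neighborFinset y).erase a).erase b := by
    intro w hw
    rw [mem_sdiff] at hw
    exact mem_erase.2 ⟨by rintro rfl; exact hw.2 hb,
      mem_erase.2 ⟨by rintro rfl; exact hw.2 ha, hw.1⟩⟩
  have := card_le_card this
  rw [card_erase_of_mem (by simpa using ⟨hab.symm, h'⟩),
    card_erase_of_mem (by simpa using h)] at this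
  have := hd y
  omega

theorem case_deg2 (hG : S.G.Connected) (hd : ∀ v, (S.G.neighborFinset v).card ≤ 3) (x : V)
    (hx : (S.G.neighborFinset x).card ≤ 2) : ∃ f, ∀ u v, S.G.Adj u v → ok S f u v := by
  have hc : (S.G.neighborFinset x \ {x}).card ≤ 2 := (card_le_card sdiff_subset).trans hx
  obtain ⟨c, hgood⟩ := good_compl hG hd {x} x (by simp) (by simpa using hc)
  obtain ⟨q, q', -, hq⟩ := two_opts hgood (y := x) (by simp) hc
  refine ⟨Function.update c x q, finish hgood _ ?_ ?_⟩
  · intro v hv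
    exact Function.update_of_ne (by simpa using hv) _ _
  · intro y hy w hw
    rw [mem_singleton] at hy
    subst hy
    have := hq q (Or.inl rfl) w (by simpa using hw.ne') hw
    rw [ok, Function.update_self, Function.update_of_ne hw.ne']
    exact this

theorem case_c4 (hG : S.G.Connected) (hd : ∀ v, (S.G.neighborFinset v).card ≤ 3)
    (x1 x2 x3 x4 : V) (h12 : S.G.Adj x1 x2) (h23 : S.G.Adj x2 x3) (h34 : S.G.Adj x3 x4)
    (h41 : S.G.Adj x4 x1) (h13 : x1 ≠ x3) (h24 : x2 ≠ x4) (n13 : ¬ S.G.Adj x1 x3)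
    (n24 : ¬ S.G.Adj x2 x4) : ∃ f, ∀ u v, S.G.Adj u v → ok S f u v := by
  obtain ⟨K, hKdef⟩ : ∃ K : Finset V, K = {x1, x2, x3, x4} := ⟨_, rfl⟩
  have m1 : x1 ∈ K := by simp [hKdef]
  have m2 : x2 ∈ K := by simp [hKdef]
  have m3 : x3 ∈ K := by simp [hKdef]
  have m4 : x4 ∈ K := by simp [hKdef]
  have hmem : ∀ y ∈ K, y = x1 ∨ y = x2 ∨ y = x3 ∨ y = x4 := by
    intro y hy; simpa [hKdef] using hy
  have o1 := out_one hd h12 m2 h41.symm m4 h24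
  have o2 := out_one hd h12.symm m1 h23 m3 h13
  have o3 := out_one hd h23.symm m2 h34 m4 h24
  have o4 := out_one hd h41 m1 h34.symm m3 h13
  obtain ⟨c, hgood⟩ := good_compl hG hd K x1 m1 (by
    intro y hy
    rcases hmem y hy with rfl | rfl | rfl | rfl <;> omega)
  obtain ⟨p1, hp1⟩ := one_opt c o1
  obtain ⟨p2, hp2⟩ := one_opt c o2
  obtain ⟨p3, hp3⟩ := one_opt c o3
  obtain ⟨p4, hp4⟩ := one_opt c o4
  obtain ⟨a1, a2, a3, a4, q1, q2, q3, q4, e12, e23, e34, e41⟩ :=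
    c4_gen (S.sign x1 x2) (S.sign x2 x3) (S.sign x3 x4) (S.sign x4 x1) p1 p2 p3 p4
  obtain ⟨f, hf, f1, f2, f3, f4⟩ : ∃ f : V → Fin 12, (∀ v, v ∉ K → f v = c v) ∧ f x1 = a1 ∧
      f x2 = a2 ∧ f x3 = a3 ∧ f x4 = a4 := by
    refine ⟨fun v => if v = x1 then a1 else if v = x2 then a2 else if v = x3 then a3 else
      if v = x4 then a4 else c v, ?_, ?_, ?_, ?_, ?_⟩
    · intro v hv
      simp only [hKdef, mem_insert, mem_singleton, not_or] at hv
      simp [hv]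
    · simp
    · simp [h12.ne']
    · simp [h13.symm, h23.ne']
    · simp [h41.ne, h24.symm, h34.ne']
  have k12 : ok S f x1 x2 := by rwa [ok, f1, f2]
  have k23 : ok S f x2 x3 := by rwa [ok, f2, f3]
  have k34 : ok S f x3 x4 := by rwa [ok, f3, f4]
  have k41 : ok S f x4 x1 := by rwa [ok, f4, f1]
  refine ⟨f, finish hgood f hf ?_⟩
  intro y hy w hw
  by_cases hwK : w ∈ K
  · rcases hmem y hy with rfl | rfl | rfl | rfl <;> rcases hmem w hwK with rfl | rfl | rfl | rfl <;>
    first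
    | assumption
    | exact ok_symm (by assumption)
    | exact absurd hw S.G.irrefl
    | exact absurd hw (by assumption)
    | exact absurd hw.symm (by assumption)
  · rcases hmem y hy with rfl | rfl | rfl | rfl
    · rw [ok, hf w hwK, f1]; exact hp1 _ q1 w hwK hw
    · rw [ok, hf w hwK, f2]; exact hp2 _ q2 w hwK hw
    · rw [ok, hf w hwK, f3]; exact hp3 _ q3 w hwK hw
    · rw [ok, hf w hwK, f4]; exact hp4 _ q4 w hwK hw

theorem case_tri (hG : S.G.Connected) (hd : ∀ v, (S.G.neighborFinset v).card ≤ 3)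
    (x u1 u2 u3 : V) (hx : ∀ w, S.G.Adj x w ↔ w = u1 ∨ w = u2 ∨ w = u3)
    (h12 : S.G.Adj u1 u2) (h13 : u1 ≠ u3) (h23 : u2 ≠ u3) (n13 : ¬ S.G.Adj u1 u3)
    (n23 : ¬ S.G.Adj u2 u3) : ∃ f, ∀ u v, S.G.Adj u v → ok S f u v := by
  have hx1 : S.G.Adj x u1 := (hx _).2 (by simp)
  have hx2 : S.G.Adj x u2 := (hx _).2 (by simp)
  have hx3 : S.G.Adj x u3 := (hx _).2 (by simp)
  obtain ⟨K, hKdef⟩ : ∃ K : Finset V, K = {x, u1, u2, u3} := ⟨_, rfl⟩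
  have m0 : x ∈ K := by simp [hKdef]
  have m1 : u1 ∈ K := by simp [hKdef]
  have m2 : u2 ∈ K := by simp [hKdef]
  have m3 : u3 ∈ K := by simp [hKdef]
  have hmem : ∀ y ∈ K, y = x ∨ y = u1 ∨ y = u2 ∨ y = u3 := by
    intro y hy; simpa [hKdef] using hy
  have o0 := out_two hd hx1 m1
  have o1 := out_one hd hx1.symm m0 h12 m2 hx2.ne
  have o2 := out_one hd hx2.symm m0 h12.symm m1 hx1.ne
  have o3 := out_two hd hx3.symm m0
  obtain ⟨c, hgood⟩ := good_compl hG hd K x m0 (by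
    intro y hy
    rcases hmem y hy with rfl | rfl | rfl | rfl <;> omega)
  obtain ⟨p1, hp1⟩ := one_opt c o1
  obtain ⟨p2, hp2⟩ := one_opt c o2
  obtain ⟨q, q', hqq, hp3⟩ := two_opts hgood m3 o3
  obtain ⟨a1, a2, a3, a0, q3, q1, q2, e12, e01, e02, e03⟩ :=
    tri_gen (S.sign u1 u2) (S.sign x u1) (S.sign x u2) (S.sign x u3) p1 p2 q q' hqq.1
  obtain ⟨f, hf, f0, f1, f2, f3⟩ : ∃ f : V → Fin 12, (∀ v, v ∉ K → f v = c v) ∧ f x = a0 ∧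
      f u1 = a1 ∧ f u2 = a2 ∧ f u3 = a3 := by
    refine ⟨fun v => if v = x then a0 else if v = u1 then a1 else if v = u2 then a2 else
      if v = u3 then a3 else c v, ?_, ?_, ?_, ?_, ?_⟩
    · intro v hv
      simp only [hKdef, mem_insert, mem_singleton, not_or] at hv
      simp [hv]
    · simp
    · simp [hx1.ne']
    · simp [hx2.ne', h12.ne']
    · simp [hx3.ne', h13.symm, h23.symm]
  have k12 : ok S f u1 u2 := by rwa [ok, f1, f2]
  have k01 : ok S f x u1 := by rwa [ok, f0, f1]
  have k02 : ok S f x u2 := by rwa [ok, f0, f2]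
  have k03 : ok S f x u3 := by rwa [ok, f0, f3]
  refine ⟨f, finish hgood f hf ?_⟩
  intro y hy w hw
  by_cases hwK : w ∈ K
  · rcases hmem y hy with rfl | rfl | rfl | rfl <;> rcases hmem w hwK with rfl | rfl | rfl | rfl <;>
    first
    | assumption
    | exact ok_symm (by assumption)
    | exact absurd hw S.G.irrefl
    | exact absurd hw (by assumption)
    | exact absurd hw.symm (by assumption)
  · rcases hmem y hy with rfl | rfl | rfl | rfl
    · rcases (hx w).1 hw with rfl | rfl | rfl <;> exact absurd (by assumption) hwK
    · rw [ok, hf w hwK, f1]; exact hp1 _ q1 w hwK hw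
    · rw [ok, hf w hwK, f2]; exact hp2 _ q2 w hwK hw
    · rw [ok, hf w hwK, f3]; exact hp3 _ q3 w hwK hw

theorem case_ds (hG : S.G.Connected) (hd : ∀ v, (S.G.neighborFinset v).card ≤ 3)
    (x y a b c d : V) (hx : ∀ w, S.G.Adj x w ↔ w = y ∨ w = a ∨ w = b)
    (hy : ∀ w, S.G.Adj y w ↔ w = x ∨ w = c ∨ w = d)
    (ya : y ≠ a) (yb : y ≠ b) (ab : a ≠ b) (xc : x ≠ c) (xd : x ≠ d) (cd : c ≠ d)
    (ac : a ≠ c) (ad : a ≠ d) (bc : b ≠ c) (bd : b ≠ d)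
    (nab : ¬ S.G.Adj a b) (nac : ¬ S.G.Adj a c) (nad : ¬ S.G.Adj a d) (nbc : ¬ S.G.Adj b c)
    (nbd : ¬ S.G.Adj b d) (ncd : ¬ S.G.Adj c d) : ∃ f, ∀ u v, S.G.Adj u v → ok S f u v := by
  have hxy : S.G.Adj x y := (hx _).2 (by simp)
  have hxa : S.G.Adj x a := (hx _).2 (by simp)
  have hxb : S.G.Adj x b := (hx _).2 (by simp)
  have hyc : S.G.Adj y c := (hy _).2 (by simp)
  have hyd : S.G.Adj y d := (hy _).2 (by simp)
  have nya : ¬ S.G.Adj y a := by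
    rw [hy]; rintro (h | h | h)
    · exact hxa.ne' h
    · exact ac h
    · exact ad h
  have nyb : ¬ S.G.Adj y b := by
    rw [hy]; rintro (h | h | h)
    · exact hxb.ne' h
    · exact bc h
    · exact bd h
  have nxc : ¬ S.G.Adj x c := by
    rw [hx]; rintro (h | h | h)
    · exact hyc.ne' h
    · exact ac h.symm
    · exact bc h.symm
  have nxd : ¬ S.G.Adj x d := by
    rw [hx]; rintro (h | h | h)
    · exact hyd.ne' h
    · exact ad h.symm
    · exact bd h.symm
  obtain ⟨K, hKdef⟩ : ∃ K : Finset V, K = {x, y, a, b, c, d} := ⟨_, rfl⟩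
  have mx : x ∈ K := by simp [hKdef]
  have my : y ∈ K := by simp [hKdef]
  have ma : a ∈ K := by simp [hKdef]
  have mb : b ∈ K := by simp [hKdef]
  have mc : c ∈ K := by simp [hKdef]
  have md : d ∈ K := by simp [hKdef]
  have hmem : ∀ z ∈ K, z = x ∨ z = y ∨ z = a ∨ z = b ∨ z = c ∨ z = d := by
    intro y hy; simpa [hKdef] using hy
  have ox := out_two hd hxy my
  have oy := out_two hd hxy.symm mx
  have oa := out_two hd hxa.symm mx
  have ob := out_two hd hxb.symm mx
  have oc := out_two hd hyc.symm my
  have od := out_two hd hyd.symm my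
  obtain ⟨c0, hgood⟩ := good_compl hG hd K x mx (by
    intro y hy
    rcases hmem y hy with rfl | rfl | rfl | rfl | rfl | rfl <;> assumption)
  obtain ⟨qa, qa', hqa, hpa⟩ := two_opts hgood ma oa
  obtain ⟨qb, qb', hqb, hpb⟩ := two_opts hgood mb ob
  obtain ⟨qc, qc', hqc, hpc⟩ := two_opts hgood mc oc
  obtain ⟨qd, qd', hqd, hpd⟩ := two_opts hgood md od
  obtain ⟨vx, vy, va, vb, vc, vd, ia, ib, ic, id, exy, exa, exb, eyc, eyd⟩ :=
    ds_gen (S.sign x y) (S.sign x a) (S.sign x b) (S.sign y c) (S.sign y d)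
      qa qa' qb qb' qc qc' qd qd' hqa hqb hqc hqd
  obtain ⟨f, hf, fx, fy, fa, fb, fc, fd⟩ : ∃ f : V → Fin 12, (∀ v, v ∉ K → f v = c0 v) ∧
      f x = vx ∧ f y = vy ∧ f a = va ∧ f b = vb ∧ f c = vc ∧ f d = vd := by
    refine ⟨fun v => if v = x then vx else if v = y then vy else if v = a then va else
      if v = b then vb else if v = c then vc else if v = d then vd else c0 v,
      ?_, ?_, ?_, ?_, ?_, ?_, ?_⟩
    · intro v hv
      simp only [hKdef, mem_insert, mem_singleton, not_or] at hv
      simp [hv]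
    · simp
    · simp [hxy.ne']
    · simp [hxa.ne', ya.symm]
    · simp [hxb.ne', yb.symm, ab.symm]
    · simp [xc.symm, hyc.ne', ac.symm, bc.symm]
    · simp [xd.symm, hyd.ne', ad.symm, bd.symm, cd.symm]
  have kxy : ok S f x y := by rwa [ok, fx, fy]
  have kxa : ok S f x a := by rwa [ok, fx, fa]
  have kxb : ok S f x b := by rwa [ok, fx, fb]
  have kyc : ok S f y c := by rwa [ok, fy, fc]
  have kyd : ok S f y d := by rwa [ok, fy, fd]
  refine ⟨f, finish hgood f hf ?_⟩
  intro z hz w hw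
  by_cases hwK : w ∈ K
  · rcases hmem z hz with rfl | rfl | rfl | rfl | rfl | rfl <;>
    rcases hmem w hwK with rfl | rfl | rfl | rfl | rfl | rfl <;>
    first
    | assumption
    | exact ok_symm (by assumption)
    | exact absurd hw S.G.irrefl
    | exact absurd hw (by assumption)
    | exact absurd hw.symm (by assumption)
  · rcases hmem z hz with rfl | rfl | rfl | rfl | rfl | rfl
    · rcases (hx w).1 hw with rfl | rfl | rfl <;> exact absurd (by assumption) hwK
    · rcases (hy w).1 hw with rfl | rfl | rfl <;> exact absurd (by assumption) hwK
    · rw [ok, hf w hwK, fa]; exact hpa _ ia w hwK hw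
    · rw [ok, hf w hwK, fb]; exact hpb _ ib w hwK hw
    · rw [ok, hf w hwK, fc]; exact hpc _ ic w hwK hw
    · rw [ok, hf w hwK, fd]; exact hpd _ id w hwK hw

theorem nbr_two (v a : V) (h3 : (S.G.neighborFinset v).card = 3) (ha : S.G.Adj v a) :
    ∃ b c, a ≠ b ∧ a ≠ c ∧ b ≠ c ∧ ∀ w, S.G.Adj v w ↔ w = a ∨ w = b ∨ w = c := by
  have h2 : ((S.G.neighborFinset v).erase a).card = 2 := by
    rw [card_erase_of_mem (by simpa using ha), h3]
  obtain ⟨b, c, hbc, he⟩ := card_eq_two.1 h2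
  have hm : ∀ w, w ≠ a ∧ S.G.Adj v w ↔ w = b ∨ w = c := by
    intro w
    have : w ∈ (S.G.neighborFinset v).erase a ↔ w ∈ ({b, c} : Finset V) := by rw [he]
    simpa using this
  refine ⟨b, c, ((hm b).2 (Or.inl rfl)).1.symm, ((hm c).2 (Or.inr rfl)).1.symm, hbc, ?_⟩
  intro w
  by_cases hw : w = a
  · subst hw; simp [ha]
  · rw [← hm w]; simp [hw]

theorem nbr_one (v a b : V) (h3 : (S.G.neighborFinset v).card = 3) (ha : S.G.Adj v a)
    (hb : S.G.Adj v b) (hab : a ≠ b) :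
    ∃ c, a ≠ c ∧ b ≠ c ∧ ∀ w, S.G.Adj v w ↔ w = a ∨ w = b ∨ w = c := by
  obtain ⟨b', c', h1, h2, h3, h4⟩ := nbr_two v a h3 ha
  rcases (h4 b).1 hb with h | h | h
  · exact absurd h.symm hab
  · subst h; exact ⟨c', h2, h3, h4⟩
  · subst h; exact ⟨b', h1, h3.symm, fun w => by rw [h4]; tauto⟩

theorem closed_univ (hG : S.G.Connected) (K : Finset V) (x : V) (hx : x ∈ K)
    (hK : ∀ y ∈ K, ∀ w, S.G.Adj y w → w ∈ K) : Fintype.card V ≤ K.card := by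
  have : ∀ u v : V, S.G.Walk u v → u ∈ K → v ∈ K := by
    intro u v p
    induction p with
    | nil => exact id
    | cons h _ ih => exact fun hu => ih (hK _ hu _ h)
  have hall : ∀ v, v ∈ K := by
    intro v
    obtain ⟨p⟩ := hG.preconnected x v
    exact this x v p hx
  rw [← card_univ]
  exact card_le_card fun v _ => hall v

/-- two triangles sharing the edge `a b` (tips `c` and `a'`) -/
theorem diamond (hG : S.G.Connected) (hd : ∀ v, (S.G.neighborFinset v).card = 3)
    (a b c a' : V) (hab : S.G.Adj a b) (hac : S.G.Adj a c) (hbc : S.G.Adj b c)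
    (ha' : S.G.Adj a a') (hb' : S.G.Adj b a') (hca' : c ≠ a') : chromS S ≤ 6 := by
  have hd' : ∀ v, (S.G.neighborFinset v).card ≤ 3 := fun v => (hd v).le
  have na : ∀ w, S.G.Adj a w → w = b ∨ w = c ∨ w = a' := by
    obtain ⟨e, e1, e2, he⟩ := nbr_one a b c (hd a) hab hac hbc.ne
    rcases (he a').1 ha' with h | h | h
    · exact absurd h hb'.ne'
    · exact absurd h hca'.symm
    · subst h; exact fun w => (he w).1
  have nb : ∀ w, S.G.Adj b w → w = a ∨ w = c ∨ w = a' := by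
    obtain ⟨e, e1, e2, he⟩ := nbr_one b a c (hd b) hab.symm hbc hac.ne
    rcases (he a').1 hb' with h | h | h
    · exact absurd h ha'.ne'
    · exact absurd h hca'.symm
    · subst h; exact fun w => (he w).1
  obtain ⟨c', c1, c2, hc'⟩ := nbr_one c a b (hd c) hac.symm hbc.symm hab.ne
  have hcc' : S.G.Adj c c' := (hc' c').2 (by simp)
  by_cases hEq : c' = a'
  · subst hEq
    have nc' : ∀ w, S.G.Adj c' w → w = a ∨ w = b ∨ w = c := by
      obtain ⟨e, e1, e2, he⟩ := nbr_one c' a b (hd c') ha'.symm hb'.symm hab.ne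
      rcases (he c).1 hcc'.symm with h | h | h
      · exact absurd h hac.ne'
      · exact absurd h hbc.ne'
      · subst h; exact fun w => (he w).1
    have := closed_univ hG {a, b, c, c'} a (by simp) (by
      intro y hy w hw
      simp only [mem_insert, mem_singleton] at hy ⊢
      rcases hy with rfl | rfl | rfl | rfl
      · have := na w hw; tauto
      · have := nb w hw; tauto
      · have := (hc' w).1 hw; tauto
      · have := nc' w hw; tauto)
    have h2 := chromS_le_card S
    have h4 : ({a, b, c, c'} : Finset V).card ≤ 4 := card_le_four
    omega
  · obtain ⟨f, hf⟩ := case_tri hG hd' c a b c' hc' hab c1 c2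
      (by
        intro h
        rcases na _ h with h | h | h
        · exact c2 h.symm
        · exact hcc'.ne' h
        · exact hEq h)
      (by
        intro h
        rcases nb _ h with h | h | h
        · exact c1 h.symm
        · exact hcc'.ne' h
        · exact hEq h)
    exact chromS_le_of_col S f hf

theorem upper (S : SignedGraph V) (hG : S.G.Connected)
    (hd' : ∀ v, (S.G.neighborFinset v).card ≤ 3) : chromS S ≤ 6 := by
  by_cases hd : ∀ v, (S.G.neighborFinset v).card = 3
  swap
  · push Not at hd
    obtain ⟨x, hx⟩ := hd
    have := hd' x
    obtain ⟨f, hf⟩ := case_deg2 hG hd' x (by omega)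
    exact chromS_le_of_col S f hf
  by_cases htri : ∃ a b c, S.G.Adj a b ∧ S.G.Adj a c ∧ S.G.Adj b c
  · obtain ⟨a, b, c, hab, hac, hbc⟩ := htri
    obtain ⟨a', a1, a2, ha'⟩ := nbr_one a b c (hd a) hab hac hbc.ne
    have haa' : S.G.Adj a a' := (ha' a').2 (by simp)
    by_cases h1 : S.G.Adj b a'
    · exact diamond hG hd a b c a' hab hac hbc haa' h1 a2
    by_cases h2 : S.G.Adj c a'
    · exact diamond hG hd a c b a' hac hab hbc.symm haa' h2 a1
    obtain ⟨f, hf⟩ := case_tri hG hd' a b c a' ha' hbc a1 a2 h1 h2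
    exact chromS_le_of_col S f hf
  have tf : ∀ a b c, S.G.Adj a b → S.G.Adj a c → ¬ S.G.Adj b c :=
    fun a b c h1 h2 h3 => htri ⟨a, b, c, h1, h2, h3⟩
  by_cases hc4 : ∃ x1 x2 x3 x4, S.G.Adj x1 x2 ∧ S.G.Adj x2 x3 ∧ S.G.Adj x3 x4 ∧ S.G.Adj x4 x1 ∧
      x1 ≠ x3 ∧ x2 ≠ x4
  · obtain ⟨x1, x2, x3, x4, h12, h23, h34, h41, h13, h24⟩ := hc4
    obtain ⟨f, hf⟩ := case_c4 hG hd' x1 x2 x3 x4 h12 h23 h34 h41 h13 h24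
      (tf x2 _ _ h12.symm h23) (tf x1 _ _ h12 h41.symm)
    exact chromS_le_of_col S f hf
  have nf : ∀ x1 x2 x3 x4, S.G.Adj x1 x2 → S.G.Adj x2 x3 → S.G.Adj x3 x4 → x1 ≠ x3 → x2 ≠ x4 →
      ¬ S.G.Adj x4 x1 :=
    fun x1 x2 x3 x4 a1 a2 a3 a5 a6 a4 => hc4 ⟨x1, x2, x3, x4, a1, a2, a3, a4, a5, a6⟩
  obtain ⟨x⟩ := hG.nonempty
  obtain ⟨y, hy0⟩ : (S.G.neighborFinset x).Nonempty := by
    rw [← card_pos, hd x]; omega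
  have hxy : S.G.Adj x y := by simpa using hy0
  obtain ⟨a, b, ya, yb, ab, hx⟩ := nbr_two x y (hd x) hxy
  obtain ⟨c, d, xc, xd, cd, hy⟩ := nbr_two y x (hd y) hxy.symm
  have hxa : S.G.Adj x a := (hx _).2 (by simp)
  have hxb : S.G.Adj x b := (hx _).2 (by simp)
  have hyc : S.G.Adj y c := (hy _).2 (by simp)
  have hyd : S.G.Adj y d := (hy _).2 (by simp)
  have ne : ∀ u v, S.G.Adj x u → S.G.Adj y v → u ≠ v := by
    rintro u v hu hv rfl
    exact tf x y u hxy hu hv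
  have nadj : ∀ u v, S.G.Adj x u → S.G.Adj y v → y ≠ u → x ≠ v → ¬ S.G.Adj u v := by
    intro u v hu hv h1 h2 h
    exact nf u x y v hu.symm hxy hv h1.symm h2 h.symm
  obtain ⟨f, hf⟩ := case_ds hG hd' x y a b c d hx hy ya yb ab xc xd cd
    (ne _ _ hxa hyc) (ne _ _ hxa hyd) (ne _ _ hxb hyc) (ne _ _ hxb hyd)
    (tf x _ _ hxa hxb) (nadj _ _ hxa hyc ya xc) (nadj _ _ hxa hyd ya xd)
    (nadj _ _ hxb hyc yb xc) (nadj _ _ hxb hyd yb xd) (tf y _ _ hyc hyd)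
  exact chromS_le_of_col S f hf

end

/-- `K_{3,3}` with a negative perfect matching -/
def exS : SignedGraph (Fin 6) where
  G := { Adj := fun u v => u.1 % 2 ≠ v.1 % 2
         symm := ⟨fun _ _ h => h.symm⟩
         loopless := ⟨fun _ h => h rfl⟩ }
  sign u v := u.1 / 2 != v.1 / 2
  sign_symm u v := bne_comm

theorem exS_adj (u v : Fin 6) : exS.G.Adj u v ↔ u.1 % 2 ≠ v.1 % 2 := Iff.rfl

theorem exS_sign (u v : Fin 6) : exS.sign u v = (u.1 / 2 != v.1 / 2) := rfl

theorem exS_pair : ∀ u v : Fin 6, u ≠ v → u.1 % 2 ≠ v.1 % 2 ∨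
    ∃ x y : Fin 6, u.1 % 2 ≠ x.1 % 2 ∧ x.1 % 2 ≠ v.1 % 2 ∧ v.1 % 2 ≠ y.1 % 2 ∧
      y.1 % 2 ≠ u.1 % 2 ∧ ((u.1 / 2 != x.1 / 2) == ((x.1 / 2 != v.1 / 2) ==
      ((v.1 / 2 != y.1 / 2) == ((y.1 / 2 != u.1 / 2) == true)))) = false := by
  decide +kernel

theorem exS_connected : exS.G.Connected := by
  have h01 : exS.G.Adj 0 1 := by rw [exS_adj]; decide
  have key : ∀ v, exS.G.Reachable 0 v := by
    intro v
    by_cases hv : v.1 % 2 = 0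
    · have : exS.G.Adj 1 v := by
        rw [exS_adj, hv]; decide
      exact h01.reachable.trans this.reachable
    · have : exS.G.Adj 0 v := by
        rw [exS_adj]; exact fun h => hv h.symm
      exact this.reachable
  exact { preconnected := fun u v => (key u).symm.trans (key v), nonempty := ⟨0⟩ }

theorem exS_deg (v : Fin 6) : (exS.G.neighborSet v).ncard ≤ 3 := by
  have : exS.G.neighborSet v = ((Finset.univ.filter fun w : Fin 6 => v.1 % 2 ≠ w.1 % 2 :
      Finset (Fin 6)) : Set (Fin 6)) := by
    ext w
    simp [exS_adj]
  rw [this, Set.ncard_coe_finset]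
  clear this
  revert v
  decide

theorem exS_lower (n : ℕ) (T : SignedGraph (Fin n)) (f : Fin 6 → Fin n) (h : IsHom exS T f) :
    6 ≤ n := by
  obtain ⟨hadj, hw⟩ := h
  have hinj : Function.Injective f := by
    intro u v huv
    by_contra hne
    rcases exS_pair u v hne with h | ⟨x, y, hux, hxv, hvy, hyu, hs⟩
    · have := hadj u v h
      rw [huv] at this
      exact T.G.irrefl this
    · have e := hw u (.cons (v := x) hux (.cons (v := v) hxv (.cons (v := y) hvy
        (.cons (v := u) hyu .nil))))
      have e1 : (T.sign (f u) (f x) == (T.sign (f x) (f v) == (T.sign (f v) (f y) ==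
        (T.sign (f y) (f u) == true)))) = false := e.trans hs
      rw [huv, T.sign_symm (f x), T.sign_symm (f y)] at e1
      revert e1
      cases T.sign (f v) (f x) <;> cases T.sign (f v) (f y) <;> simp
  have := Fintype.card_le_of_injective f hinj
  simpa using this

end SubcubicProof

open SignedGraph in
/-- The maximum signed chromatic number of connected graphs with maximum degree at
most `3` equals `6`. -/
theorem chromS_subcubic_eq_six :
    (∀ (V : Type) [Fintype V], ∀ S : SignedGraph V, S.G.Connected →
        (∀ v : V, (S.G.neighborSet v).ncard ≤ 3) → chromS S ≤ 6) ∧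
    (∃ (m : ℕ) (S : SignedGraph (Fin m)), S.G.Connected ∧
        (∀ v, (S.G.neighborSet v).ncard ≤ 3) ∧ chromS S = 6) := by
  have up : ∀ (V : Type) [Fintype V], ∀ S : SignedGraph V, S.G.Connected →
        (∀ v : V, (S.G.neighborSet v).ncard ≤ 3) → chromS S ≤ 6 := by
    intro V _ S hG hd
    classical
    apply SubcubicProof.upper S hG
    intro v
    have := hd v
    rwa [Set.ncard_eq_toFinset_card', ← SimpleGraph.neighborFinset_def] at this
  refine ⟨up, 6, SubcubicProof.exS, SubcubicProof.exS_connected, SubcubicProof.exS_deg, ?_⟩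
  apply le_antisymm (up _ _ SubcubicProof.exS_connected SubcubicProof.exS_deg)
  have hne : {n : ℕ | ∃ T : SignedGraph (Fin n), ∃ f : Fin 6 → Fin n,
      IsHom SubcubicProof.exS T f}.Nonempty := by
    by_contra hemp
    rw [Set.not_nonempty_iff_eq_empty] at hemp
    have : IsHom SubcubicProof.exS SubcubicProof.exS id := by
      refine ⟨fun _ _ h => h, fun u w => ?_⟩
      congr 1
      exact SimpleGraph.Walk.map_id w
    have h6 : 6 ∈ {n : ℕ | ∃ T : SignedGraph (Fin n), ∃ f : Fin 6 → Fin n,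
      IsHom SubcubicProof.exS T f} := ⟨_, _, this⟩
    rw [hemp] at h6
    exact h6
  obtain ⟨T, f, hf⟩ := Nat.sInf_mem hne
  exact SubcubicProof.exS_lower _ T f hf
end
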